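/- arXiv:1111.0601 — 4 statements merged into one kernel-verified Lean document; each statement's English description precedes it below -/
import Mathlib

section
/- Let q ∈ ℝ with q ≠ 0. Then for every x ∈ ℝ and every integer n ≥ 1: Σ_{j=0}^{n} [n choose j]_q · h_j(x|q) · b_{n−j}(x|q) = 0. -/
open Finset

section Defs

variable {K : Type*} [Field K]

/-- q-Pochhammer symbol `(a; q)_n = ∏_{j=0}^{n-1} (1 - a q^j)`. -/
def qPoch (a q : K) (n : ℕ) : K := ∏ j ∈ Finset.range n, (1 - a * q ^ j)

/-- Gaussian (q-binomial) coefficient `[n choose k]_q`. -/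
def qBinom (q : K) : ℕ → ℕ → K
  | _, 0 => 1
  | 0, _ + 1 => 0
  | n + 1, k + 1 => qBinom q n k + q ^ (k + 1) * qBinom q n (k + 1)

/-- Continuous q-Hermite polynomials `h_n(x|q)`:
`h_{-1} = 0`, `h_0 = 1`, `h_{n+1} = 2x h_n - (1 - q^n) h_{n-1}`. -/
def hQH (q x : K) : ℕ → K
  | 0 => 1
  | 1 => 2 * x
  | n + 2 => 2 * x * hQH q x (n + 1) - (1 - q ^ (n + 1)) * hQH q x n

/-- The polynomials `b_n(x|q) = (-1)^n q^{n(n-1)/2} h_n(x|q^{-1})` (for `q ≠ 0`). -/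
def bQH (q x : K) (n : ℕ) : K := (-1) ^ n * q ^ (n * (n - 1) / 2) * hQH q⁻¹ x n

/-- Al-Salam–Chihara polynomials in conjugate-pair parametrization `p_n(x|y,ρ,q)`:
`p_{-1} = 0`, `p_0 = 1`,
`p_{n+1} = 2(x - ρ y q^n) p_n - (1 - q^n)(1 - ρ² q^{n-1}) p_{n-1}`. -/
def pASC (q x y ρ : K) : ℕ → K
  | 0 => 1
  | 1 => 2 * (x - ρ * y)
  | n + 2 => 2 * (x - ρ * y * q ^ (n + 1)) * pASC q x y ρ (n + 1)
      - (1 - q ^ (n + 1)) * (1 - ρ ^ 2 * q ^ n) * pASC q x y ρ n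

open Classical in
/-- The polynomials `g_n(x|y,ρ,q)`: `ρ^n p_n(y|x,ρ⁻¹,q)` for `ρ ≠ 0`, `b_n(x|q)` for `ρ = 0`. -/
noncomputable def gASC (q x y ρ : K) (n : ℕ) : K :=
  if ρ = 0 then bQH q x n else ρ ^ n * pASC q y x ρ⁻¹ n

/-- `ω(u,v|ρ) = (1-ρ²)² - 4uvρ(1+ρ²) + 4ρ²(u²+v²)`. -/
def omegaW (u v ρ : K) : K :=
  (1 - ρ ^ 2) ^ 2 - 4 * u * v * ρ * (1 + ρ ^ 2) + 4 * ρ ^ 2 * (u ^ 2 + v ^ 2)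

/-- `v(x|t) = 1 - 2xt + t²`. -/
def vQH (x t : K) : K := 1 - 2 * x * t + t ^ 2

/-- Coefficient `e_n(a,b,c,d,q)` of the Askey–Wilson three-term recurrence. -/
def eAW (a b c d q : K) (n : ℕ) : K :=
  q ^ ((n : ℤ) - 2) /
      ((1 - a * b * c * d * q ^ (2 * (n : ℤ) - 2)) * (1 - a * b * c * d * q ^ (2 * (n : ℤ)))) *
    ((a + b + c + d) * (q ^ 2 - a * b * c * d * q ^ (n : ℤ) * (1 + q - q ^ ((n : ℤ) + 1))) +
      (a * b * c + a * b * d + a * c * d + b * c * d) *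
        (q - q ^ ((n : ℤ) + 2) - q ^ ((n : ℤ) + 1) + a * b * c * d * q ^ (2 * (n : ℤ))))

/-- Coefficient `f_n(a,b,c,d,q)` of the Askey–Wilson three-term recurrence. -/
def fAW (a b c d q : K) (n : ℕ) : K :=
  (1 - q ^ (n : ℤ)) * (1 - a * b * q ^ ((n : ℤ) - 1)) * (1 - a * c * q ^ ((n : ℤ) - 1)) *
      (1 - a * d * q ^ ((n : ℤ) - 1)) * (1 - b * c * q ^ ((n : ℤ) - 1)) *
      (1 - b * d * q ^ ((n : ℤ) - 1)) * (1 - c * d * q ^ ((n : ℤ) - 1)) *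
      (1 - a * b * c * d * q ^ ((n : ℤ) - 2)) /
    (qPoch (a * b * c * d * q ^ (2 * (n : ℤ) - 3)) q 3 *
      (1 - a * b * c * d * q ^ (2 * (n : ℤ) - 2)))

/-- Monic Askey–Wilson polynomials `α_n(x|a,b,c,d,q)`:
`α_{-1} = 0`, `α_0 = 1`, `α_{n+1} = (2x - e_n) α_n - f_n α_{n-1}`. -/
def alphaAW (a b c d q x : K) : ℕ → K
  | 0 => 1
  | 1 => 2 * x - eAW a b c d q 0
  | n + 2 => (2 * x - eAW a b c d q (n + 1)) * alphaAW a b c d q x (n + 1) -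
      fAW a b c d q (n + 1) * alphaAW a b c d q x n

/-- Coefficient of `ψ_n` in the continuous dual Hahn recurrence:
`q^n (b+c+d) + bcd q^{n-1} (1 - q^{n+1} - q^n)`. -/
def ePsi (b c d q : K) (n : ℕ) : K :=
  q ^ (n : ℤ) * (b + c + d) + b * c * d * q ^ ((n : ℤ) - 1) * (1 - q ^ ((n : ℤ) + 1) - q ^ (n : ℤ))

/-- Coefficient of `ψ_{n-1}` in the continuous dual Hahn recurrence:
`(1-q^n)(1-bcq^{n-1})(1-bdq^{n-1})(1-cdq^{n-1})`. -/
def fPsi (b c d q : K) (n : ℕ) : K :=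
  (1 - q ^ (n : ℤ)) * (1 - b * c * q ^ ((n : ℤ) - 1)) * (1 - b * d * q ^ ((n : ℤ) - 1)) *
    (1 - c * d * q ^ ((n : ℤ) - 1))

/-- Continuous dual Hahn polynomials `ψ_n(x|b,c,d,q)`:
`ψ_{-1} = 0`, `ψ_0 = 1`, `ψ_{n+1} = (2x - ePsi_n) ψ_n - fPsi_n ψ_{n-1}`. -/
def psiCDH (b c d q x : K) : ℕ → K
  | 0 => 1
  | 1 => 2 * x - ePsi b c d q 0
  | n + 2 => (2 * x - ePsi b c d q (n + 1)) * psiCDH b c d q x (n + 1) -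
      fPsi b c d q (n + 1) * psiCDH b c d q x n

/-- Al-Salam–Chihara polynomials `Q_n(x|c,d,q)`:
`Q_{-1} = 0`, `Q_0 = 1`, `Q_{n+1} = (2x - q^n(c+d)) Q_n - (1-q^n)(1-cdq^{n-1}) Q_{n-1}`. -/
def qASC (c d q x : K) : ℕ → K
  | 0 => 1
  | 1 => 2 * x - (c + d)
  | n + 2 => (2 * x - q ^ (n + 1) * (c + d)) * qASC c d q x (n + 1) -
      (1 - q ^ (n + 1)) * (1 - c * d * q ^ n) * qASC c d q x n

/-- Coefficient `ẽ_n` of the conjugate-pair Askey–Wilson recurrence. -/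
def eW (y ρ₁ z ρ₂ q : K) (n : ℕ) : K :=
  2 * q ^ ((n : ℤ) - 1) /
      ((1 - ρ₁ ^ 2 * ρ₂ ^ 2 * q ^ (2 * (n : ℤ) - 2)) *
        (1 - ρ₁ ^ 2 * ρ₂ ^ 2 * q ^ (2 * (n : ℤ)))) *
    (q * (ρ₁ * y + ρ₂ * z) *
        (1 - ρ₁ ^ 2 * ρ₂ ^ 2 * q ^ ((n : ℤ) - 2) * (1 + q - q ^ ((n : ℤ) + 1))) +
      ρ₁ * ρ₂ * (ρ₁ * z + ρ₂ * y) *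
        (1 - q ^ ((n : ℤ) + 1) - q ^ (n : ℤ) + ρ₁ ^ 2 * ρ₂ ^ 2 * q ^ (2 * (n : ℤ) - 1)))

/-- Coefficient `f̃_n` of the conjugate-pair Askey–Wilson recurrence. -/
def fW (y ρ₁ z ρ₂ q : K) (n : ℕ) : K :=
  (1 - q ^ (n : ℤ)) * omegaW y z (ρ₁ * ρ₂ * q ^ ((n : ℤ) - 1)) *
      (1 - ρ₁ ^ 2 * q ^ ((n : ℤ) - 1)) * (1 - ρ₂ ^ 2 * q ^ ((n : ℤ) - 1)) *
      (1 - ρ₁ ^ 2 * ρ₂ ^ 2 * q ^ ((n : ℤ) - 2)) /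
    (qPoch (ρ₁ ^ 2 * ρ₂ ^ 2 * q ^ (2 * (n : ℤ) - 3)) q 3 *
      (1 - ρ₁ ^ 2 * ρ₂ ^ 2 * q ^ (2 * (n : ℤ) - 2)))

/-- Conjugate-pair Askey–Wilson polynomials `w_n(x|y,ρ₁,z,ρ₂,q)`:
`w_{-1} = 0`, `w_0 = 1`, `w_{n+1} = (2x - ẽ_n) w_n - f̃_n w_{n-1}`. -/
def wAW (x y ρ₁ z ρ₂ q : K) : ℕ → K
  | 0 => 1
  | 1 => 2 * x - eW y ρ₁ z ρ₂ q 0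
  | n + 2 => (2 * x - eW y ρ₁ z ρ₂ q (n + 1)) * wAW x y ρ₁ z ρ₂ q (n + 1) -
      fW y ρ₁ z ρ₂ q (n + 1) * wAW x y ρ₁ z ρ₂ q n

/-- Chebyshev polynomials of the second kind. -/
def chebU (x : K) : ℕ → K
  | 0 => 1
  | 1 => 2 * x
  | n + 2 => 2 * x * chebU x (n + 1) - chebU x n

/-- The quantity `A_n` from the Askey–Wilson recurrence factorization. -/
def A_AW (a b c d q : K) (n : ℕ) : K :=
  (1 - a * b * q ^ (n : ℤ)) * (1 - a * c * q ^ (n : ℤ)) * (1 - a * d * q ^ (n : ℤ)) *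
      (1 - a * b * c * d * q ^ ((n : ℤ) - 1)) /
    (a * (1 - a * b * c * d * q ^ (2 * (n : ℤ) - 1)) * (1 - a * b * c * d * q ^ (2 * (n : ℤ))))

/-- The quantity `C_n` from the Askey–Wilson recurrence factorization. -/
def C_AW (a b c d q : K) (n : ℕ) : K :=
  a * (1 - q ^ (n : ℤ)) * (1 - b * c * q ^ ((n : ℤ) - 1)) * (1 - b * d * q ^ ((n : ℤ) - 1)) *
      (1 - c * d * q ^ ((n : ℤ) - 1)) /
    ((1 - a * b * c * d * q ^ (2 * (n : ℤ) - 2)) * (1 - a * b * c * d * q ^ (2 * (n : ℤ) - 1)))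

end Defs

section QHermite

variable {K : Type*} [Field K]

lemma qBinom_eq_zero_of_lt (q : K) : ∀ {n k : ℕ}, n < k → qBinom q n k = 0
  | 0, 0, h => absurd h (lt_irrefl 0)
  | n + 1, 0, h => absurd h (Nat.not_lt_zero _)
  | 0, k + 1, _ => by simp [qBinom]
  | n + 1, k + 1, h => by
    rw [qBinom, qBinom_eq_zero_of_lt q (by omega : n < k),
      qBinom_eq_zero_of_lt q (by omega : n < k + 1), mul_zero, add_zero]

lemma qBinom_zero_right (q : K) (n : ℕ) : qBinom q n 0 = 1 := by
  cases n <;> simp [qBinom]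

/-- For `n < k` both sides vanish, so truncated subtraction is harmless. -/
lemma qBinom_succ_right_mul (q : K) (n k : ℕ) :
    qBinom q n (k + 1) * (1 - q ^ (k + 1)) = qBinom q n k * (1 - q ^ (n - k)) := by
  induction n generalizing k with
  | zero => simp [qBinom]
  | succ n ih =>
    have hleft : qBinom q (n + 1) (k + 1) * (1 - q ^ (k + 1)) =
        qBinom q n k * (1 - q ^ (n - k) * q ^ (k + 1)) := by
      rw [qBinom]
      linear_combination q ^ (k + 1) * ih k
    rw [hleft]
    cases k with
    | zero => simp [qBinom_zero_right, ← pow_succ]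
    | succ i =>
      rcases Nat.lt_or_ge n (i + 1) with hlt | hge
      · rw [qBinom_eq_zero_of_lt q hlt, Nat.sub_eq_zero_of_le (by omega : n + 1 ≤ i + 1)]
        simp
      · obtain ⟨m, rfl⟩ := Nat.exists_eq_add_of_le hge
        have hi := ih i
        rw [show i + 1 + m - i = m + 1 by omega] at hi
        rw [show i + 1 + m - (i + 1) = m by omega,
          show i + 1 + m + 1 - (i + 1) = m + 1 by omega, qBinom]
        linear_combination hi

/-- The second `q`-Pascal rule. -/
lemma qBinom_succ_succ' (q : K) (n k : ℕ) :
    qBinom q (n + 1) (k + 1) = q ^ (n - k) * qBinom q n k + qBinom q n (k + 1) := by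
  rw [qBinom]
  linear_combination -qBinom_succ_right_mul q n k

lemma sum_qBinom_succ_mul (q : K) (f : ℕ → K) (n : ℕ) :
    ∑ j ∈ range (n + 2), qBinom q (n + 1) j * f j =
      ∑ j ∈ range (n + 1), qBinom q n j * (f j + q ^ (n - j) * f (j + 1)) := by
  have hshift : ∑ j ∈ range (n + 1), qBinom q n j * f j =
      ∑ j ∈ range (n + 1), qBinom q n (j + 1) * f (j + 1) + f 0 := by
    have h := sum_range_succ' (fun j => qBinom q n j * f j) (n + 1)
    rw [sum_range_succ, qBinom_eq_zero_of_lt q (Nat.lt_succ_self n)] at h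
    simpa [qBinom_zero_right] using h
  rw [sum_range_succ', qBinom_zero_right, one_mul]
  simp_rw [mul_add, qBinom_succ_succ', add_mul]
  rw [sum_add_distrib, sum_add_distrib, hshift]
  have hcomm : ∀ j, q ^ (n - j) * qBinom q n j * f (j + 1) =
      qBinom q n j * (q ^ (n - j) * f (j + 1)) := fun j => by ring
  simp_rw [hcomm]
  ring

lemma hQH_succ (q x : K) (n : ℕ) :
    hQH q x (n + 1) = 2 * x * hQH q x n - (1 - q ^ n) * hQH q x (n - 1) := by
  cases n <;> simp [hQH]

lemma bQH_succ {q : K} (hq : q ≠ 0) (x : K) (n : ℕ) :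
    bQH q x (n + 1) =
      -(2 * x * q ^ n * bQH q x n) + q ^ (n - 1) * (1 - q ^ n) * bQH q x (n - 1) := by
  cases n with
  | zero => simp [bQH, hQH]
  | succ m =>
    have hdiv (k : ℕ) : (k + 1) * k / 2 = k * (k - 1) / 2 + k := by
      rw [← Finset.sum_range_id, ← sum_range_succ (fun i => i) k, Finset.sum_range_id,
        Nat.add_sub_cancel]
    simp only [bQH, hdiv, Nat.add_sub_cancel, hQH_succ q⁻¹ x (m + 1), inv_pow]
    have hpow : q ^ (m + 1) * (q ^ (m + 1))⁻¹ = 1 := mul_inv_cancel₀ (pow_ne_zero _ hq)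
    linear_combination (-1) ^ m * q ^ (m * (m - 1) / 2) * q ^ m * hQH q⁻¹ x m * hpow

end QHermite

/-- Lemma: `∑_{j=0}^n [n choose j]_q h_j(x|q) b_{n-j}(x|q) = 0` for `n ≥ 1`. -/
theorem hQH_bQH_convolution (q : ℝ) (hq : q ≠ 0) (x : ℝ) (n : ℕ) (hn : 1 ≤ n) :
    ∑ j ∈ Finset.range (n + 1), qBinom q n j * hQH q x j * bQH q x (n - j) = 0 := by
  obtain ⟨n, rfl⟩ := Nat.exists_eq_add_of_le' hn
  simp_rw [mul_assoc]
  rw [sum_qBinom_succ_mul q (fun j => hQH q x j * bQH q x (n + 1 - j))]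
  let U : ℕ → ℝ := fun j =>
    qBinom q n j * (q ^ (n - j) * (1 - q ^ j) * hQH q x (j - 1) * bQH q x (n - j))
  have hU : ∀ j ∈ range (n + 1), qBinom q n j * (hQH q x j * bQH q x (n + 1 - j) +
      q ^ (n - j) * (hQH q x (j + 1) * bQH q x (n + 1 - (j + 1)))) = U (j + 1) - U j := by
    intro j hj
    rw [Nat.succ_sub (Nat.lt_succ_iff.mp (mem_range.mp hj)), Nat.succ_eq_add_one,
      Nat.add_sub_add_right, bQH_succ hq, hQH_succ]
    simp only [U, Nat.add_sub_cancel, ← Nat.sub_sub]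
    linear_combination -(q ^ (n - j - 1) * hQH q x j * bQH q x (n - j - 1)) *
      qBinom_succ_right_mul q n j
  rw [sum_congr rfl hU, sum_range_sub]
  simp [U, qBinom_eq_zero_of_lt q (Nat.lt_succ_self n)]
end

section
/- Let q, ρ ∈ ℝ with q ≠ 0 and ρ ≠ 0. Then for every x, y ∈ ℝ and every integer n ≥ 0: g_n(x|y,ρ,q) = (−1)^n · q^{n(n−1)/2} · p_n(x|y,ρ,q^{−1}). -/
open Finset

/-- Proposition: `g_n(x|y,ρ,q) = (-1)^n q^{n(n-1)/2} p_n(x|y,ρ,q⁻¹)`. -/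
theorem gASC_eq_pASC_qinv (q ρ : ℝ) (hq : q ≠ 0) (hρ : ρ ≠ 0) (x y : ℝ) (n : ℕ) :
    gASC q x y ρ n = (-1) ^ n * q ^ (n * (n - 1) / 2) * pASC q⁻¹ x y ρ n := by
  simp only [gASC, if_neg hρ]
  induction n using Nat.twoStepInduction with
  | zero => simp [pASC]
  | one =>
    simp only [pASC]
    field_simp
    norm_num
  | more n ih₀ ih₁ =>
    have hexp : ∀ m : ℕ, q ^ ((m + 1) * (m + 1 - 1) / 2) = q ^ (m * (m - 1) / 2) * q ^ m :=
      fun m => by rw [Nat.triangle_succ, pow_add]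
    rw [hexp (n + 1)]
    rw [hexp n] at ih₁ ⊢
    simp only [pASC]
    have hstep : ρ ^ (n + 2) * (2 * (y - ρ⁻¹ * x * q ^ (n + 1)) * pASC q y x ρ⁻¹ (n + 1)
          - (1 - q ^ (n + 1)) * (1 - ρ⁻¹ ^ 2 * q ^ n) * pASC q y x ρ⁻¹ n)
        = 2 * (ρ * y - x * q ^ (n + 1)) * (ρ ^ (n + 1) * pASC q y x ρ⁻¹ (n + 1))
          - (1 - q ^ (n + 1)) * (ρ ^ 2 - q ^ n) * (ρ ^ n * pASC q y x ρ⁻¹ n) := by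
      generalize pASC q y x ρ⁻¹ (n + 1) = a, pASC q y x ρ⁻¹ n = b
      field_simp
      ring
    rw [hstep, ih₀, ih₁]
    generalize pASC q⁻¹ x y ρ (n + 1) = a, pASC q⁻¹ x y ρ n = b
    simp only [pow_succ q⁻¹ n, pow_succ q n, inv_pow]
    have hqn : q ^ n ≠ 0 := pow_ne_zero n hq
    generalize q ^ n = r at hqn ⊢
    field_simp
    ring
end

section
/- Let q ∈ ℝ with q ≠ 0. Then for every x, y, ρ ∈ ℝ and every integer n ≥ 0: g_{n+1}(x|y,ρ,q) = −2(xq^n − ρy)·g_n(x|y,ρ,q) − (1−q^n)(ρ² − q^{n−1})·g_{n−1}(x|y,ρ,q), where g_{−1}(x|y,ρ,q) = 0 and g_0(x|y,ρ,q) = 1. -/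
open Finset

theorem bQH_add_two {K : Type*} [Field K] {q : K} (hq : q ≠ 0) (x : K) (n : ℕ) :
    bQH q x (n + 2) =
      -2 * (x * q ^ (n + 1)) * bQH q x (n + 1) + (1 - q ^ (n + 1)) * q ^ n * bQH q x n := by
  have triangle_succ (m : ℕ) : (m + 1) * (m + 1 - 1) / 2 = m * (m - 1) / 2 + m := by
    simpa only [Finset.sum_range_id] using Finset.sum_range_succ (fun i : ℕ => i) m
  simp only [bQH, hQH, triangle_succ (n + 1), triangle_succ n, pow_add, inv_pow]
  field_simp
  ring

theorem pow_mul_pASC_inv_add_two {K : Type*} [Field K] {ρ : K} (hρ : ρ ≠ 0) (q x y : K) (n : ℕ) :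
    ρ ^ (n + 2) * pASC q y x ρ⁻¹ (n + 2) =
      -2 * (x * q ^ (n + 1) - ρ * y) * (ρ ^ (n + 1) * pASC q y x ρ⁻¹ (n + 1)) -
        (1 - q ^ (n + 1)) * (ρ ^ 2 - q ^ n) * (ρ ^ n * pASC q y x ρ⁻¹ n) := by
  simp only [pASC]
  field_simp
  ring

/-- Proposition: three-term recurrence for `g_n(x|y,ρ,q)` (with `g_{-1} = 0`, `g_0 = 1`). -/
theorem gASC_recurrence (q : ℝ) (hq : q ≠ 0) (x y ρ : ℝ) (n : ℕ) :
    gASC q x y ρ (n + 1) =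
      -2 * (x * q ^ n - ρ * y) * gASC q x y ρ n -
        (1 - q ^ n) * (ρ ^ 2 - q ^ ((n : ℤ) - 1)) * gASC q x y ρ (n - 1) := by
  by_cases hρ : ρ = 0
  · subst hρ
    simp only [gASC, if_true]
    cases n with
    | zero => simp [bQH, hQH]
    | succ n =>
      simp only [Nat.cast_add, Nat.cast_one, add_sub_cancel_right, zpow_natCast,
        Nat.add_sub_cancel, bQH_add_two hq]
      ring
  · simp only [gASC, if_neg hρ]
    cases n with
    | zero =>
      simp only [pASC]
      field_simp
      ring
    | succ n =>
      simp only [Nat.cast_add, Nat.cast_one, add_sub_cancel_right, zpow_natCast,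
        Nat.add_sub_cancel]
      exact pow_mul_pASC_inv_add_two hρ q x y n
end

section
/- Let ρ1, ρ2, θ, η, q ∈ ℝ with q ≠ 0 and ρ1²ρ2²·q^j ≠ 1 for every integer j ≥ −1. Put a = ρ1·e^{iθ}, b = ρ1·e^{−iθ}, c = ρ2·e^{iη}, d = ρ2·e^{−iη}, y = cos θ, z = cos η. Then for every integer n ≥ 0 the following equalities hold in ℂ (the right-hand sides being real): (i) f_n(a,b,c,d,q) = (1−q^n)·ω(y,z|ρ1ρ2q^{n−1})·(1−ρ1²q^{n−1})(1−ρ2²q^{n−1})(1−ρ1²ρ2²q^{n−2}) / [(ρ1²ρ2²q^{2n−3};q)_3·(1−ρ1²ρ2²q^{2n−2})]; (ii) e_n(a,b,c,d,q) = [2q^{n−1}/((1−ρ1²ρ2²q^{2n−2})(1−ρ1²ρ2²q^{2n}))]·[q(ρ1y+ρ2z)(1 − ρ1²ρ2²q^{n−2}(1+q−q^{n+1})) + ρ1ρ2(ρ1z+ρ2y)(1 − q^{n+1} − q^n + ρ1²ρ2²q^{2n−1})]. -/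
open Finset

/-- Over a field of characteristic `≠ 2`, `ω` at the midpoints of two inverse pairs factors
into four linear factors. -/
lemma omegaW_eq_prod {K : Type*} [Field K] [NeZero (2 : K)] (r E E' F F' : K)
    (hE : E * E' = 1) (hF : F * F' = 1) :
    omegaW ((E + E') / 2) ((F + F') / 2) r =
      (1 - r * (E * F)) * (1 - r * (E * F')) * (1 - r * (E' * F)) * (1 - r * (E' * F')) := by
  have h2 : (2 : K) ≠ 0 := NeZero.ne 2
  have hE0 : E ≠ 0 := left_ne_zero_of_mul_eq_one hE
  have hF0 : F ≠ 0 := left_ne_zero_of_mul_eq_one hF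
  obtain rfl : E' = E⁻¹ := eq_inv_of_mul_eq_one_right hE
  obtain rfl : F' = F⁻¹ := eq_inv_of_mul_eq_one_right hF
  unfold omegaW
  field_simp
  ring

lemma fAW_conjugate_pair {K : Type*} [Field K] [NeZero (2 : K)] (ρ₁ ρ₂ q E E' F F' : K)
    (hE : E * E' = 1) (hF : F * F' = 1) (n : ℕ) :
    fAW (ρ₁ * E) (ρ₁ * E') (ρ₂ * F) (ρ₂ * F') q n =
      fW ((E + E') / 2) ρ₁ ((F + F') / 2) ρ₂ q n := by
  have hab : ρ₁ * E * (ρ₁ * E') = ρ₁ ^ 2 := by linear_combination ρ₁ ^ 2 * hE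
  have hcd : ρ₂ * F * (ρ₂ * F') = ρ₂ ^ 2 := by linear_combination ρ₂ ^ 2 * hF
  have habcd : ρ₁ * E * (ρ₁ * E') * (ρ₂ * F) * (ρ₂ * F') = ρ₁ ^ 2 * ρ₂ ^ 2 := by
    rw [mul_assoc _ (ρ₂ * F), hab, hcd]
  unfold fAW fW
  rw [habcd, hab, hcd, omegaW_eq_prod _ E E' F F' hE hF]
  congr 1
  ring

lemma eAW_conjugate_pair {K : Type*} [Field K] [NeZero (2 : K)] (ρ₁ ρ₂ q E E' F F' : K)
    (hq : q ≠ 0) (hE : E * E' = 1) (hF : F * F' = 1) (n : ℕ) :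
    eAW (ρ₁ * E) (ρ₁ * E') (ρ₂ * F) (ρ₂ * F') q n =
      eW ((E + E') / 2) ρ₁ ((F + F') / 2) ρ₂ q n := by
  have h2 : (2 : K) ≠ 0 := NeZero.ne 2
  have hab : ρ₁ * E * (ρ₁ * E') = ρ₁ ^ 2 := by linear_combination ρ₁ ^ 2 * hE
  have hcd : ρ₂ * F * (ρ₂ * F') = ρ₂ ^ 2 := by linear_combination ρ₂ ^ 2 * hF
  have habcd : ρ₁ * E * (ρ₁ * E') * (ρ₂ * F) * (ρ₂ * F') = ρ₁ ^ 2 * ρ₂ ^ 2 := by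
    rw [mul_assoc _ (ρ₂ * F), hab, hcd]
  have htriple : ρ₁ * E * (ρ₁ * E') * (ρ₂ * F) + ρ₁ * E * (ρ₁ * E') * (ρ₂ * F') +
      ρ₁ * E * (ρ₂ * F) * (ρ₂ * F') + ρ₁ * E' * (ρ₂ * F) * (ρ₂ * F') =
      ρ₁ * ρ₂ * (ρ₁ * (F + F') + ρ₂ * (E + E')) := by
    linear_combination ρ₂ * (F + F') * hab + ρ₁ * (E + E') * hcd
  unfold eAW eW
  rw [habcd, htriple, div_mul_eq_mul_div, div_mul_eq_mul_div]
  congr 1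
  simp only [zpow_sub₀ hq, zpow_add₀ hq, two_mul (n : ℤ), zpow_ofNat]
  field_simp
  ring

lemma ofReal_fW (y ρ₁ z ρ₂ q : ℝ) (n : ℕ) :
    ((fW y ρ₁ z ρ₂ q n : ℝ) : ℂ) = fW (y : ℂ) ρ₁ z ρ₂ q n := by
  simp [fW, omegaW, qPoch]

lemma ofReal_eW (y ρ₁ z ρ₂ q : ℝ) (n : ℕ) :
    ((eW y ρ₁ z ρ₂ q n : ℝ) : ℂ) = eW (y : ℂ) ρ₁ z ρ₂ q n := by
  simp [eW]

/-- Proposition: the AW recurrence coefficients in the complex-conjugate-pair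
parametrization are the real quantities `f̃_n` and `ẽ_n`. -/
theorem aw_coeffs_conjugate_pair (ρ₁ ρ₂ θ η q : ℝ) (hq : q ≠ 0)
    (h : ∀ j : ℤ, -1 ≤ j → ρ₁ ^ 2 * ρ₂ ^ 2 * q ^ j ≠ 1) (n : ℕ) :
    fAW ((ρ₁ : ℂ) * Complex.exp ((θ : ℂ) * Complex.I))
        ((ρ₁ : ℂ) * Complex.exp (-(θ : ℂ) * Complex.I))
        ((ρ₂ : ℂ) * Complex.exp ((η : ℂ) * Complex.I))
        ((ρ₂ : ℂ) * Complex.exp (-(η : ℂ) * Complex.I)) (q : ℂ) n =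
      ((fW (Real.cos θ) ρ₁ (Real.cos η) ρ₂ q n : ℝ) : ℂ) ∧
    eAW ((ρ₁ : ℂ) * Complex.exp ((θ : ℂ) * Complex.I))
        ((ρ₁ : ℂ) * Complex.exp (-(θ : ℂ) * Complex.I))
        ((ρ₂ : ℂ) * Complex.exp ((η : ℂ) * Complex.I))
        ((ρ₂ : ℂ) * Complex.exp (-(η : ℂ) * Complex.I)) (q : ℂ) n =
      ((eW (Real.cos θ) ρ₁ (Real.cos η) ρ₂ q n : ℝ) : ℂ) := by
  have hcos (t : ℝ) : ((Real.cos t : ℝ) : ℂ) =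
      (Complex.exp ((t : ℂ) * Complex.I) + Complex.exp (-(t : ℂ) * Complex.I)) / 2 := by
    rw [Complex.ofReal_cos, Complex.cos]
  have hexp (t : ℝ) :
      Complex.exp ((t : ℂ) * Complex.I) * Complex.exp (-(t : ℂ) * Complex.I) = 1 := by
    rw [← Complex.exp_add]
    simp
  have hq' : (q : ℂ) ≠ 0 := Complex.ofReal_ne_zero.mpr hq
  rw [ofReal_fW, ofReal_eW, hcos, hcos]
  exact ⟨fAW_conjugate_pair _ _ _ _ _ _ _ (hexp θ) (hexp η) n,
    eAW_conjugate_pair _ _ _ _ _ _ _ hq' (hexp θ) (hexp η) n⟩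
end
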